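/- arXiv:1503.07281 — 3 statements merged into one kernel-verified Lean document; each statement's English description precedes it below -/
import Mathlib

section
/- Let d = gcd(m, ℓ) and let q_1,…,q_s be the distinct prime divisors of m/d. There exist m-th roots of unity x_1,…,x_n with x_1^ℓ + ⋯ + x_n^ℓ = 0 if and only if n = n_1 q_1 + ⋯ + n_s q_s for some non-negative integers n_1,…,n_s. -/
open Polynomial

lemma step_arith (p P R : ℕ) (S : AddSubmonoid ℕ) (hp : p ∈ S) (hPR : P ≤ R) (hRp : R < p)
    (a b : Fin p → ℕ) (hb : ∑ j, b j < P)
    (H : ∀ i j, b i = 0 → a i + b j < P →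
      (∃ s ∈ S, a j = a i + b j + s) ∨ P * R ≤ a j + (a i + b j) * R) :
    (∃ s ∈ S, ∑ j, a j = ∑ j, b j + s) ∨ P * R ≤ ∑ j, a j + (∑ j, b j) * R := by
  classical
  -- a zero of b
  have hz : ∃ i, b i = 0 := by
    by_contra! h
    have : ∑ j : Fin p, 1 ≤ ∑ j, b j :=
      Finset.sum_le_sum (fun j _ => Nat.one_le_iff_ne_zero.mpr (h j))
    simp at this
    omega
  obtain ⟨i, hi, hmin⟩ : ∃ i, b i = 0 ∧ ∀ k, b k = 0 → a i ≤ a k := by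
    have hne : (Finset.univ.filter (fun i => b i = 0)).Nonempty := by
      obtain ⟨i, hi⟩ := hz
      exact ⟨i, by simp [hi]⟩
    obtain ⟨i, hi, h⟩ := Finset.exists_min_image _ a hne
    exact ⟨i, by simpa using hi, fun k hk => h k (by simp [hk])⟩
  have key : ∀ (u : ℕ) (j : Fin p), u ≤ a i → u ≤ R → P * R ≤ a j + (u + b j) * R →
      P * R ≤ ∑ j, a j + (∑ j, b j) * R := by
    intro u j hu huR h
    have h1 : ∑ k ∈ Finset.univ.erase j, u ≤ ∑ k ∈ Finset.univ.erase j, (a k + u * b k) := by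
      apply Finset.sum_le_sum
      intro k _
      by_cases hk : b k = 0
      · have := hmin k hk
        omega
      · have : 1 ≤ b k := Nat.one_le_iff_ne_zero.mpr hk
        nlinarith
    rw [Finset.sum_add_distrib, ← Finset.mul_sum] at h1
    simp only [Finset.sum_const, smul_eq_mul, Finset.card_erase_of_mem (Finset.mem_univ j),
      Finset.card_univ, Fintype.card_fin] at h1
    rw [← Finset.add_sum_erase _ a (Finset.mem_univ j),
      ← Finset.add_sum_erase _ b (Finset.mem_univ j)]
    set A := ∑ k ∈ Finset.univ.erase j, a k
    set B := ∑ k ∈ Finset.univ.erase j, b k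
    have h2 : R * u ≤ (p - 1) * u := Nat.mul_le_mul_right _ (by omega)
    have h3 : u * B ≤ R * B := Nat.mul_le_mul_right _ huR
    nlinarith
  by_cases hall : ∀ j, a i + b j < P ∧ ∃ s ∈ S, a j = a i + b j + s
  · left
    choose h1 s hs hs' using hall
    refine ⟨p * a i + ∑ j, s j, S.add_mem ?_ (S.sum_mem fun j _ => hs j), ?_⟩
    · rw [mul_comm]; simpa using S.nsmul_mem hp (a i)
    · rw [Finset.sum_congr rfl (fun j _ => hs' j)]
      simp [Finset.sum_add_distrib]
      ring
  · right
    push Not at hall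
    obtain ⟨j, hj⟩ := hall
    by_cases h1 : a i + b j < P
    · rcases H i j hi h1 with ⟨s, hs, h⟩ | h
      · exact absurd h (hj h1 s hs)
      · exact key (a i) j le_rfl (by omega) h
    · refine key (min (a i) R) j (min_le_left _ _) (min_le_right _ _) ?_
      have : P ≤ min (a i) R + b j := by
        rcases le_total (a i) R with h | h <;> simp [h] <;> omega
      have := Nat.mul_le_mul_right R this
      omega

/-- multiset decomposition -/
lemma decomp (p M M' : ℕ) (ω : ℂ)
    (hω : ∀ z : ℂ, z ^ M = 1 → ∃ (j : Fin p) (w : ℂ), w ^ M' = 1 ∧ z = ω ^ (j : ℕ) * w)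
    (x : Multiset ℂ) (hx : ∀ z ∈ x, z ^ M = 1) :
    ∃ X : Fin p → Multiset ℂ, (∀ j, ∀ w ∈ X j, w ^ M' = 1) ∧
      x.card = ∑ j, (X j).card ∧ x.sum = ∑ j : Fin p, (X j).sum * ω ^ (j : ℕ) := by
  classical
  induction x using Multiset.induction_on with
  | empty => exact ⟨fun _ => 0, by simp⟩
  | cons z x ih =>
    obtain ⟨X, h1, h2, h3⟩ := ih (fun z hz => hx z (Multiset.mem_cons_of_mem hz))
    obtain ⟨j, w, hw, hz⟩ := hω z (hx z (Multiset.mem_cons_self _ _))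
    refine ⟨fun k => (if k = j then {w} else 0) + X k, ?_, ?_, ?_⟩
    · intro k v hv
      rw [Multiset.mem_add] at hv
      rcases hv with hv | hv
      · split_ifs at hv
        · rw [Multiset.mem_singleton] at hv; rw [hv, hw]
        · simp at hv
      · exact h1 k v hv
    · simp only [Multiset.card_add, Finset.sum_add_distrib, Multiset.card_cons, h2]
      simp [apply_ite Multiset.card, add_comm]
    · simp only [Multiset.sum_add, Finset.sum_add_distrib, Multiset.sum_cons, h3, add_mul]
      simp [apply_ite Multiset.sum, hz, mul_comm]

lemma lin_indep (K : IntermediateField ℚ ℂ) (ω : ℂ) (D : ℕ)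
    (hD : D ≤ (minpoly K ω).natDegree) (a : ℕ → ℂ) (ha : ∀ j, a j ∈ K)
    (h : ∑ j ∈ Finset.range D, a j * ω ^ j = 0) : ∀ j < D, a j = 0 := by
  intro j hj
  let f : K[X] := ∑ j ∈ Finset.range D, C ⟨a j, ha j⟩ * X ^ j
  have hdeg : f.degree < D := by
    refine (Polynomial.degree_sum_le _ _).trans_lt ?_
    rw [Finset.sup_lt_iff (by exact WithBot.bot_lt_coe D)]
    intro i hi
    exact (degree_C_mul_X_pow_le _ _).trans_lt (by exact_mod_cast Finset.mem_range.mp hi)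
  have hf : aeval ω f = 0 := by
    simp only [f, map_sum, map_mul, aeval_C, map_pow, aeval_X]
    exact h
  have hf0 : f = 0 := by
    by_contra hne
    have h1 := minpoly.degree_le_of_ne_zero K ω hne hf
    have h2 := h1.trans_lt hdeg
    by_cases hm : minpoly K ω = 0
    · simp [hm] at hD; omega
    · rw [degree_eq_natDegree hm] at h2
      have : (minpoly K ω).natDegree < D := by exact_mod_cast h2
      omega
  have hc : f.coeff j = ⟨a j, ha j⟩ := by
    simp [f, coeff_X_pow, hj]
  rw [hf0] at hc
  simpa using (congrArg Subtype.val hc).symm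

open IntermediateField in
lemma deg_bound (M M' D : ℕ) (hM : 0 < M) (hM' : 0 < M') (ζ' ζ ω : ℂ)
    (h' : IsPrimitiveRoot ζ' M') (h : IsPrimitiveRoot ζ M)
    (hD : M.totient = M'.totient * D) (hint : IsIntegral ℚ ω)
    (hmem : ∃ v ∈ ℚ⟮ζ'⟯, ∃ k : ℕ, ζ = v * ω ^ k) :
    D ≤ (minpoly ℚ⟮ζ'⟯ ω).natDegree := by
  set K := ℚ⟮ζ'⟯ with hK
  have i' : IsIntegral ℚ ζ' := (h'.isIntegral hM').tower_top
  have i : IsIntegral ℚ ζ := (h.isIntegral hM).tower_top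
  have e1 : Module.finrank ℚ K = M'.totient := by
    rw [hK, adjoin.finrank i', ← cyclotomic_eq_minpoly_rat h' hM', natDegree_cyclotomic]
  have e2 : Module.finrank ℚ ℚ⟮ζ⟯ = M.totient := by
    rw [adjoin.finrank i, ← cyclotomic_eq_minpoly_rat h hM, natDegree_cyclotomic]
  have iω : IsIntegral K ω := hint.tower_top
  have e3 := adjoin.finrank iω
  have : FiniteDimensional ℚ K := adjoin.finiteDimensional i'
  have : FiniteDimensional K K⟮ω⟯ := adjoin.finiteDimensional iω
  have e4 := Module.finrank_mul_finrank ℚ K K⟮ω⟯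
  have : FiniteDimensional ℚ K⟮ω⟯ := FiniteDimensional.trans ℚ K K⟮ω⟯
  have hle : ℚ⟮ζ⟯ ≤ (K⟮ω⟯).restrictScalars ℚ := by
    rw [adjoin_simple_le_iff, mem_restrictScalars]
    obtain ⟨v, hv, k, rfl⟩ := hmem
    refine mul_mem ?_ (pow_mem (mem_adjoin_simple_self K ω) k)
    exact _root_.algebraMap_mem K⟮ω⟯ (⟨v, hv⟩ : K)
  have : FiniteDimensional ℚ ((K⟮ω⟯).restrictScalars ℚ) := ‹FiniteDimensional ℚ K⟮ω⟯›
  have e5 : Module.finrank ℚ ℚ⟮ζ⟯ ≤ Module.finrank ℚ ((K⟮ω⟯).restrictScalars ℚ) :=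
    IntermediateField.finrank_le_of_le_right hle
  have e6 : Module.finrank ℚ ((K⟮ω⟯).restrictScalars ℚ) = Module.finrank ℚ K⟮ω⟯ := rfl
  rw [e6, ← e4, e2, e1, e3, hD] at e5
  exact Nat.le_of_mul_le_mul_left e5 (Nat.totient_pos.mpr hM')

lemma lin_indep_fin (K : IntermediateField ℚ ℂ) (ω : ℂ) (D : ℕ)
    (hD : D ≤ (minpoly K ω).natDegree) (a : Fin D → ℂ) (ha : ∀ j, a j ∈ K)
    (h : ∑ j, a j * ω ^ (j : ℕ) = 0) (j : Fin D) : a j = 0 := by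
  have := lin_indep K ω D hD (fun j => if h : j < D then a ⟨j, h⟩ else 0)
    (by intro j; split_ifs; exacts [ha _, K.zero_mem])
    (by rw [Finset.sum_range]; simpa using h) j j.2
  simpa using this

open IntermediateField in
lemma sum_mem_field (M' : ℕ) (hM' : 0 < M') (ζ' : ℂ) (h' : IsPrimitiveRoot ζ' M')
    (x : Multiset ℂ) (hx : ∀ z ∈ x, z ^ M' = 1) : x.sum ∈ ℚ⟮ζ'⟯ := by
  apply multiset_sum_mem
  intro z hz
  have : NeZero M' := ⟨hM'.ne'⟩
  obtain ⟨i, -, rfl⟩ := h'.eq_pow_of_pow_eq_one (hx z hz)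
  exact pow_mem (mem_adjoin_simple_self ℚ ζ') i

lemma omega_split (p M' : ℕ) (hp : 0 < p) (ω : ℂ) (hω : IsPrimitiveRoot (ω ^ M') p) (z : ℂ)
    (hz : z ^ (p * M') = 1) :
    ∃ (j : Fin p) (w : ℂ), w ^ M' = 1 ∧ z = ω ^ (j : ℕ) * w := by
  have : NeZero p := ⟨hp.ne'⟩
  obtain ⟨j, hj, h⟩ := hω.eq_pow_of_pow_eq_one (ξ := z ^ M') (by rw [← pow_mul, mul_comm, hz])
  by_cases h0 : ω = 0
  · subst h0
    by_cases hM : M' = 0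
    · subst hM
      refine ⟨⟨0, hp⟩, z, by simp, by simp⟩
    · rw [zero_pow hM] at hω
      have := hω.pow_eq_one
      rw [zero_pow hp.ne'] at this
      exact absurd this zero_ne_one
  · refine ⟨⟨j, hj⟩, z / ω ^ j, ?_, ?_⟩
    · rw [div_pow, ← h, ← pow_mul, ← pow_mul, mul_comm, div_self]
      exact pow_ne_zero _ h0
    · field_simp

open IntermediateField in
lemma split_power (p M' : ℕ) (hp : p.Prime) (hM' : 0 < M') (hdvd : p ∣ M')
    (x y : Multiset ℂ) (hx : ∀ z ∈ x, z ^ (p * M') = 1) (hy : ∀ z ∈ y, z ^ (p * M') = 1)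
    (hxy : x.sum = y.sum) :
    ∃ X Y : Fin p → Multiset ℂ, (∀ j, ∀ w ∈ X j, w ^ M' = 1) ∧ (∀ j, ∀ w ∈ Y j, w ^ M' = 1) ∧
      x.card = ∑ j, (X j).card ∧ y.card = ∑ j, (Y j).card ∧
      ∀ j, (X j).sum = (Y j).sum := by
  have hM : 0 < p * M' := Nat.mul_pos hp.pos hM'
  set ω := Complex.exp (2 * Real.pi * Complex.I / ((p * M' : ℕ) : ℂ)) with hωdef
  have hω : IsPrimitiveRoot ω (p * M') := Complex.isPrimitiveRoot_exp _ hM.ne'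
  have hω' : IsPrimitiveRoot (ω ^ M') p := hω.pow hM (mul_comm _ _)
  have h' : IsPrimitiveRoot (ω ^ p) M' := hω.pow hM rfl
  obtain ⟨X, hX1, hX2, hX3⟩ := decomp p _ M' ω (omega_split p M' hp.pos ω hω') x hx
  obtain ⟨Y, hY1, hY2, hY3⟩ := decomp p _ M' ω (omega_split p M' hp.pos ω hω') y hy
  refine ⟨X, Y, hX1, hY1, hX2, hY2, fun j => ?_⟩
  have hdeg := deg_bound (p * M') M' p hM hM' (ω ^ p) ω ω h' hω
    (by rw [Nat.totient_mul_of_prime_of_dvd hp hdvd, mul_comm])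
    (hω.isIntegral hM).tower_top ⟨1, one_mem _, 1, by simp⟩
  have := lin_indep_fin _ ω p hdeg (fun j => (X j).sum - (Y j).sum)
    (fun j => sub_mem (sum_mem_field M' hM' _ h' _ (hX1 j)) (sum_mem_field M' hM' _ h' _ (hY1 j)))
    (by simp only [sub_mul, Finset.sum_sub_distrib]; rw [← hX3, ← hY3, hxy, sub_self]) j
  exact sub_eq_zero.mp this

open IntermediateField in
lemma split_coprime (p M' : ℕ) (hp : p.Prime) (hM' : 0 < M') (hdvd : ¬ p ∣ M')
    (x y : Multiset ℂ) (hx : ∀ z ∈ x, z ^ (p * M') = 1) (hy : ∀ z ∈ y, z ^ (p * M') = 1)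
    (hxy : x.sum = y.sum) :
    ∃ X Y : Fin p → Multiset ℂ, (∀ j, ∀ w ∈ X j, w ^ M' = 1) ∧ (∀ j, ∀ w ∈ Y j, w ^ M' = 1) ∧
      x.card = ∑ j, (X j).card ∧ y.card = ∑ j, (Y j).card ∧
      ∀ i j, (X i).sum + (Y j).sum = (X j).sum + (Y i).sum := by
  have hM : 0 < p * M' := Nat.mul_pos hp.pos hM'
  have hcop : p.Coprime M' := (Nat.Prime.coprime_iff_not_dvd hp).mpr hdvd
  obtain ⟨ζ, hζ⟩ : ∃ ζ : ℂ, IsPrimitiveRoot ζ (p * M') := ⟨_, Complex.isPrimitiveRoot_exp _ hM.ne'⟩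
  obtain ⟨ω, hω⟩ : ∃ ω : ℂ, IsPrimitiveRoot ω p := ⟨_, Complex.isPrimitiveRoot_exp _ hp.ne_zero⟩
  obtain ⟨ζ', h'⟩ : ∃ ζ : ℂ, IsPrimitiveRoot ζ M' := ⟨_, Complex.isPrimitiveRoot_exp _ hM'.ne'⟩
  have hω' : IsPrimitiveRoot (ω ^ M') p := hω.pow_of_coprime _ hcop.symm
  obtain ⟨X, hX1, hX2, hX3⟩ := decomp p _ M' ω (omega_split p M' hp.pos ω hω') x hx
  obtain ⟨Y, hY1, hY2, hY3⟩ := decomp p _ M' ω (omega_split p M' hp.pos ω hω') y hy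
  refine ⟨X, Y, hX1, hY1, hX2, hY2, ?_⟩
  obtain ⟨q, rfl⟩ : ∃ q, p = q + 1 := ⟨p - 1, by have := hp.pos; omega⟩
  have hdeg := deg_bound ((q + 1) * M') M' q hM hM' ζ' ζ ω h' hζ
    (by rw [Nat.totient_mul hcop, Nat.totient_prime hp, mul_comm, Nat.add_sub_cancel])
    (hω.isIntegral hp.pos).tower_top (by
      obtain ⟨j, w, hw, hz⟩ := omega_split _ M' hp.pos ω hω' ζ hζ.pow_eq_one
      refine ⟨w, ?_, j, by rw [hz, mul_comm]⟩
      simpa using sum_mem_field M' hM' ζ' h' {w} (by simpa using hw))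
  have hgeom := hω.geom_sum_eq_zero hp.one_lt
  rw [Finset.sum_range, Fin.sum_univ_castSucc] at hgeom
  have hsum : ∑ j, ((X j).sum - (Y j).sum) * ω ^ (j : ℕ) = 0 := by
    simp only [sub_mul, Finset.sum_sub_distrib]; rw [← hX3, ← hY3, hxy, sub_self]
  rw [Fin.sum_univ_castSucc] at hsum
  have hmem : ∀ j, (X j).sum - (Y j).sum ∈ ℚ⟮ζ'⟯ := fun j =>
    sub_mem (sum_mem_field M' hM' _ h' _ (hX1 j)) (sum_mem_field M' hM' _ h' _ (hY1 j))
  have key := lin_indep_fin _ ω q hdeg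
    (fun j => ((X j.castSucc).sum - (Y j.castSucc).sum) - ((X (Fin.last q)).sum - (Y (Fin.last q)).sum))
    (fun j => sub_mem (hmem _) (hmem _))
    (by
      simp only [sub_mul _ ((X (Fin.last q)).sum - (Y (Fin.last q)).sum), Finset.sum_sub_distrib,
        ← Finset.mul_sum]
      simp only [Fin.val_castSucc] at hsum hgeom ⊢
      linear_combination hsum - ((X (Fin.last q)).sum - (Y (Fin.last q)).sum) * hgeom)
  have key2 : ∀ j, (X j).sum - (Y j).sum = (X (Fin.last q)).sum - (Y (Fin.last q)).sum := by
    intro j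
    induction j using Fin.lastCases with
    | last => rfl
    | cast j => exact sub_eq_zero.mp (key j)
  intro i j
  linear_combination key2 i - key2 j

lemma lam_leung_aux (P R : ℕ) (S : AddSubmonoid ℕ) (hPR : P ≤ R) (N : ℕ)
    (hS : ∀ p, p.Prime → p ∣ N → p ∈ S) (hPQ : ∀ p, p.Prime → p ∣ N → p = P ∨ R < p) (M : ℕ) :
    0 < M → M ∣ N → ∀ x y : Multiset ℂ, (∀ z ∈ x, z ^ M = 1) → (∀ z ∈ y, z ^ M = 1) →
      x.sum = y.sum → y.card < P →
      (∃ s ∈ S, x.card = y.card + s) ∨ P * R ≤ x.card + y.card * R := by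
  induction M using Nat.strong_induction_on with
  | _ M ih =>
  intro hM hMN x y hx hy hxy hcard
  -- the case of order one
  have hone : ∀ x : Multiset ℂ, (∀ z ∈ x, z ^ 1 = 1) → x.sum = x.card := by
    intro x hx
    have h : x = Multiset.replicate x.card 1 := Multiset.eq_replicate_card.mpr (fun z hz => by simpa using hx z hz)
    rw [h]
    simp
  rcases Nat.lt_or_ge 1 M with hM1 | hM1
  · -- largest prime factor
    obtain ⟨p, hpm, hmax⟩ := Finset.exists_max_image M.primeFactors id
      (Nat.nonempty_primeFactors.mpr hM1)
    have hp := Nat.prime_of_mem_primeFactors hpm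
    obtain ⟨M', rfl⟩ := Nat.dvd_of_mem_primeFactors hpm
    have hM' : 0 < M' := Nat.pos_of_mul_pos_left hM
    have hlt : M' < p * M' := by
      have := hp.two_le
      nlinarith
    have hpN : p ∣ N := (Dvd.intro _ rfl).trans hMN
    have IH := ih M' hlt hM' ((Dvd.intro_left _ rfl).trans hMN)
    by_cases hdvd : p ∣ M'
    · obtain ⟨X, Y, hX, hY, hXc, hYc, hsum⟩ := split_power p M' hp hM' hdvd x y hx hy hxy
      have hle : ∀ j, (Y j).card ≤ y.card := fun j => by
        rw [hYc]; exact Finset.single_le_sum (f := fun j => (Y j).card) (by simp) (Finset.mem_univ j)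
      have hle' : ∀ j, (X j).card ≤ x.card := fun j => by
        rw [hXc]; exact Finset.single_le_sum (f := fun j => (X j).card) (by simp) (Finset.mem_univ j)
      have H := fun j => IH (X j) (Y j) (hX j) (hY j) (hsum j) ((hle j).trans_lt hcard)
      by_cases hall : ∀ j, ∃ s ∈ S, (X j).card = (Y j).card + s
      · left
        choose s hs h using hall
        refine ⟨∑ j, s j, S.sum_mem fun j _ => hs j, ?_⟩
        rw [hXc, hYc, ← Finset.sum_add_distrib]
        exact Finset.sum_congr rfl fun j _ => h j
      · right
        push Not at hall
        obtain ⟨j, hj⟩ := hall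
        rcases H j with ⟨s, hs, h⟩ | h
        · exact absurd h (hj s hs)
        · have h1 := Nat.mul_le_mul_right R (hle j)
          have h2 := hle' j
          omega
    · obtain ⟨X, Y, hX, hY, hXc, hYc, hsum⟩ := split_coprime p M' hp hM' hdvd x y hx hy hxy
      rcases hPQ p hp hpN with rfl | hRp
      · -- then M' = 1
        have hM1' : M' = 1 := by
          by_contra hne
          have hq := Nat.minFac_prime hne
          have hqd := Nat.minFac_dvd M'
          have hqle : M'.minFac ≤ p := hmax _ (by
            rw [Nat.mem_primeFactors]
            exact ⟨hq, hqd.mul_left _, hM.ne'⟩)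
          have hqN : M'.minFac ∣ N := (hqd.mul_left p).trans hMN
          rcases hPQ _ hq hqN with h | h
          · exact hdvd (h ▸ hqd)
          · omega
        subst hM1'
        have hsum' : ∀ i j, (X i).card + (Y j).card = (X j).card + (Y i).card := by
          intro i j
          have := hsum i j
          rw [hone _ (hX i), hone _ (hX j), hone _ (hY i), hone _ (hY j)] at this
          exact_mod_cast this
        left
        have hz : ∃ i, (Y i).card = 0 := by
          by_contra! h
          have : ∑ j : Fin p, 1 ≤ ∑ j, (Y j).card :=
            Finset.sum_le_sum (fun j _ => Nat.one_le_iff_ne_zero.mpr (h j))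
          simp at this
          omega
        obtain ⟨i, hi⟩ := hz
        refine ⟨(X i).card * p, by simpa using S.nsmul_mem (hS p hp hpN) (X i).card, ?_⟩
        rw [hXc, hYc]
        have : ∀ j, (X j).card = (Y j).card + (X i).card := fun j => by
          have := hsum' i j
          omega
        rw [Finset.sum_congr rfl (fun j _ => this j)]
        simp [Finset.sum_add_distrib, mul_comm]
      · have := step_arith p P R S (hS p hp hpN) hPR hRp (fun j => (X j).card) (fun j => (Y j).card)
          (by rw [← hYc]; exact hcard) (by
            intro i j hi hij
            have hYi : Y i = 0 := Multiset.card_eq_zero.mp hi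
            have h := IH (X j) (X i + Y j) (hX j)
              (fun z hz => (Multiset.mem_add.mp hz).elim (hX i z) (hY j z))
              (by have := hsum i j; simp [hYi] at this; simp [this])
              (by simpa using hij)
            simpa using h)
        rwa [← hXc, ← hYc] at this
  · have : M = 1 := by omega
    subst this
    left
    rw [hone x hx, hone y hy] at hxy
    exact ⟨0, S.zero_mem, by exact_mod_cast hxy⟩

lemma lam_leung (N : ℕ) (hN : 0 < N) (x : Multiset ℂ) (hx : ∀ z ∈ x, z ^ N = 1)
    (hsum : x.sum = 0) : x.card ∈ AddSubmonoid.closure {p : ℕ | p.Prime ∧ p ∣ N} := by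
  set S := AddSubmonoid.closure {p : ℕ | p.Prime ∧ p ∣ N} with hSdef
  have hS : ∀ p, p.Prime → p ∣ N → p ∈ S := fun p hp hd => AddSubmonoid.subset_closure ⟨hp, hd⟩
  have aux : ∀ P R : ℕ, 0 < P → P ≤ R → (∀ p, p.Prime → p ∣ N → p = P ∨ R < p) →
      x.card ∈ S ∨ P * R ≤ x.card := by
    intro P R hP hPR hPQ
    rcases lam_leung_aux P R S hPR N hS hPQ N hN dvd_rfl x 0 hx (by simp) (by simpa using hsum)
      (by simpa using hP) with ⟨s, hs, h⟩ | h
    · left; rw [h]; simpa using hs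
    · right; simpa using h
  by_cases h1 : ∃ P, ∀ p, p.Prime → p ∣ N → p = P
  · obtain ⟨P, hP⟩ := h1
    have hall : ∃ P, 0 < P ∧ ∀ p, p.Prime → p ∣ N → p = P := by
      rcases Nat.eq_zero_or_pos P with h0 | h0
      · exact ⟨1, one_pos, fun p hp hd => absurd (hP p hp hd) (by have := hp.pos; omega)⟩
      · exact ⟨P, h0, hP⟩
    obtain ⟨P, hP0, hP⟩ := hall
    rcases aux P (P + x.card + 1) hP0 (by omega) (fun p hp hd => Or.inl (hP p hp hd)) with h | h
    · exact h
    · nlinarith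
  · push Not at h1
    have hN1 : N ≠ 1 := by
      rintro rfl
      obtain ⟨p, hp, hd, -⟩ := h1 0
      exact hp.one_lt.ne' (Nat.dvd_one.mp hd)
    set P := N.minFac with hPdef
    have hP : P.Prime := Nat.minFac_prime hN1
    have hex : ∃ q, q.Prime ∧ q ∣ N ∧ q ≠ P := h1 P
    classical
    obtain ⟨hq, hqN, hqP⟩ := Nat.find_spec hex
    have hmin := fun m hm => Nat.find_min' hex (m := m) hm
    set Q := Nat.find hex
    have hPQ : P < Q := lt_of_le_of_ne (Nat.minFac_le_of_dvd hq.two_le hqN) hqP.symm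
    rcases aux P (Q - 1) hP.pos (by omega) (fun p hp hd => by
      by_cases h : p = P
      · exact Or.inl h
      · right
        have := hmin p ⟨hp, hd, h⟩
        have := hq.pos
        omega) with h | h
    · exact h
    · have hF := frobeniusNumber_pair ((Nat.coprime_primes hP hq).mpr hqP.symm) hP.one_lt hq.one_lt
      have hc : x.card ∈ AddSubmonoid.closure ({P, Q} : Set ℕ) := by
        by_contra hn
        have h2 := hF.2 hn
        rw [Nat.mul_sub, mul_one] at h
        have h3 : P * 2 ≤ P * Q := Nat.mul_le_mul_left _ hq.two_le
        have h4 : 2 * Q ≤ P * Q := Nat.mul_le_mul_right _ hP.two_le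
        have := hP.pos
        have := hq.pos
        omega
      refine AddSubmonoid.closure_mono ?_ hc
      rintro p (rfl | rfl)
      · exact ⟨hP, Nat.minFac_dvd N⟩
      · exact ⟨hq, hqN⟩

lemma closure_to_comb (N : ℕ) (hN : 0 < N) (n : ℕ)
    (h : n ∈ AddSubmonoid.closure {p : ℕ | p.Prime ∧ p ∣ N}) :
    ∃ f : ℕ → ℕ, n = ∑ p ∈ N.primeFactors, f p * p := by
  classical
  induction h using AddSubmonoid.closure_induction with
  | mem p hp =>
    refine ⟨fun q => if q = p then 1 else 0, ?_⟩
    simp [hp.1, hp.2, hN.ne']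
  | zero => exact ⟨fun _ => 0, by simp⟩
  | add a b _ _ ha hb =>
    obtain ⟨f, rfl⟩ := ha
    obtain ⟨g, rfl⟩ := hb
    exact ⟨fun p => f p + g p, by simp [add_mul, Finset.sum_add_distrib]⟩

lemma exists_vanishing (N : ℕ) (s : Finset ℕ) (hs : s ⊆ N.primeFactors) (f : ℕ → ℕ) :
    ∃ x : Multiset ℂ, (∀ z ∈ x, z ^ N = 1) ∧ x.sum = 0 ∧ x.card = ∑ p ∈ s, f p * p := by
  classical
  induction s using Finset.induction_on with
  | empty => exact ⟨0, by simp⟩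
  | insert p s hps ih =>
    obtain ⟨x, h1, h2, h3⟩ := ih (fun q hq => hs (Finset.mem_insert_of_mem hq))
    have hpm := hs (Finset.mem_insert_self p s)
    have hp := Nat.prime_of_mem_primeFactors hpm
    obtain ⟨ω, hω⟩ : ∃ ω : ℂ, IsPrimitiveRoot ω p := ⟨_, Complex.isPrimitiveRoot_exp _ hp.ne_zero⟩
    refine ⟨f p • ((Multiset.range p).map (fun j => ω ^ j)) + x, ?_, ?_, ?_⟩
    · intro z hz
      rcases Multiset.mem_add.mp hz with hz | hz
      · obtain ⟨j, -, rfl⟩ := Multiset.mem_map.mp (Multiset.mem_of_mem_nsmul hz)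
        obtain ⟨k, hk⟩ := Nat.dvd_of_mem_primeFactors hpm
        rw [← pow_mul, mul_comm, pow_mul, hk, pow_mul, hω.pow_eq_one]
        simp
      · exact h1 z hz
    · have : ((Multiset.range p).map (fun j => ω ^ j)).sum = 0 := hω.geom_sum_eq_zero hp.one_lt
      rw [Multiset.sum_add, Multiset.sum_nsmul, this, h2]
      simp
    · simp [h3, Finset.sum_insert hps]

theorem vanishing_pow_sum_iff_prime_comb (m ℓ n : ℕ) (hm : 0 < m) (hℓ : 0 < ℓ)
    (hn : 0 < n) (d : ℕ) (hd : d = Nat.gcd m ℓ) :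
    (∃ x : Fin n → ℂ, (∀ i, x i ^ m = 1) ∧ ∑ i, (x i) ^ ℓ = 0) ↔
    (∃ f : ℕ → ℕ, n = ∑ p ∈ (m / d).primeFactors, f p * p) := by
  have hd0 : 0 < d := hd ▸ Nat.gcd_pos_of_pos_left _ hm
  have hdm : d ∣ m := hd ▸ Nat.gcd_dvd_left _ _
  have hdl : d ∣ ℓ := hd ▸ Nat.gcd_dvd_right _ _
  have hN : 0 < m / d := Nat.div_pos (Nat.le_of_dvd hm hdm) hd0
  constructor
  · rintro ⟨x, hx, hsum⟩
    apply closure_to_comb _ hN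
    have := lam_leung (m / d) hN ((Finset.univ : Finset (Fin n)).val.map (fun i => x i ^ ℓ))
      (by
        intro z hz
        obtain ⟨i, -, rfl⟩ := Multiset.mem_map.mp hz
        obtain ⟨k, hk⟩ := hdl
        rw [← pow_mul]
        have : ℓ * (m / d) = m * k := by
          rw [hk, mul_right_comm, Nat.mul_div_cancel' hdm]
        rw [this, pow_mul, hx i, one_pow]) hsum
    simpa using this
  · rintro ⟨f, hf⟩
    obtain ⟨x, h1, h2, h3⟩ := exists_vanishing (m / d) _ subset_rfl f
    rw [← hf] at h3
    obtain ⟨l, rfl⟩ := Quot.exists_rep x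
    have hlen : l.length = n := h3
    subst hlen
    obtain ⟨ζ, hζ⟩ : ∃ ζ : ℂ, IsPrimitiveRoot ζ m := ⟨_, Complex.isPrimitiveRoot_exp _ hm.ne'⟩
    have hζl : IsPrimitiveRoot (ζ ^ ℓ) (m / d) := by
      have h := IsPrimitiveRoot.orderOf (ζ ^ ℓ)
      rwa [orderOf_pow' ζ hℓ.ne', ← hζ.eq_orderOf, ← hd] at h
    have : NeZero (m / d) := ⟨hN.ne'⟩
    have hroot : ∀ i : Fin l.length, ∃ z : ℂ, z ^ m = 1 ∧ z ^ ℓ = l.get i := by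
      intro i
      obtain ⟨k, -, hk⟩ := hζl.eq_pow_of_pow_eq_one (h1 (l.get i) (List.get_mem l i))
      refine ⟨ζ ^ k, ?_, ?_⟩
      · rw [← pow_mul, mul_comm, pow_mul, hζ.pow_eq_one, one_pow]
      · rw [← hk, ← pow_mul, ← pow_mul, mul_comm]
    choose z hz1 hz2 using hroot
    refine ⟨z, hz1, ?_⟩
    rw [Finset.sum_congr rfl (fun i _ => hz2 i)]
    have h4 : l.sum = 0 := by simpa using h2
    rw [← h4]
    simp
end

section
/- For any m ≥ 2 and any n with 2 ≤ n ≤ m such that both n and m − n are non-negative integer combinations of the prime divisors of m, there exist n distinct m-th roots of unity summing to 0. -/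
/-- `S` is stable under multiplication by `d`-th roots of unity. -/
def SivStable (d : ℕ) (S : Finset ℂ) : Prop := ∀ z : ℂ, z ^ d = 1 → ∀ x ∈ S, z * x ∈ S

/-- There are `n` distinct `m`-th roots of unity summing to zero. -/
def SivV (m n : ℕ) : Prop :=
  ∃ S : Finset ℂ, S ⊆ Polynomial.nthRootsFinset m (1 : ℂ) ∧ S.card = n ∧ ∑ x ∈ S, x = 0

theorem siv_card (m : ℕ) (hm : 0 < m) : (Polynomial.nthRootsFinset m (1 : ℂ)).card = m :=
  (Complex.isPrimitiveRoot_exp m hm.ne').card_nthRootsFinset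

theorem siv_mem {m : ℕ} (hm : 0 < m) {x : ℂ} :
    x ∈ Polynomial.nthRootsFinset m (1 : ℂ) ↔ x ^ m = 1 :=
  Polynomial.mem_nthRootsFinset hm 1

theorem siv_sum {d : ℕ} (hd : 2 ≤ d) {S : Finset ℂ} (hS : SivStable d S) : ∑ x ∈ S, x = 0 := by
  have hz := Complex.isPrimitiveRoot_exp d (by omega)
  set z := Complex.exp (2 * Real.pi * Complex.I / d) with hzdef
  have hz0 : z ≠ 0 := Complex.exp_ne_zero _
  have hz1 : z ≠ 1 := hz.ne_one (by omega)
  have himg : S.image (fun x => z * x) = S := by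
    apply Finset.eq_of_subset_of_card_le
    · intro y hy
      obtain ⟨x, hx, rfl⟩ := Finset.mem_image.1 hy
      exact hS z hz.pow_eq_one x hx
    · rw [Finset.card_image_of_injective _ (mul_right_injective₀ hz0)]
  have h2 : ∑ x ∈ S, x = z * ∑ x ∈ S, x := by
    conv_lhs => rw [← himg]
    rw [Finset.sum_image (fun a _ b _ h => mul_right_injective₀ hz0 h), Finset.mul_sum]
  have h3 : (z - 1) * ∑ x ∈ S, x = 0 := by linear_combination -h2
  rcases mul_eq_zero.1 h3 with h | h
  · exact absurd (sub_eq_zero.1 h) hz1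
  · exact h

/-- The coset `x μ_d`. -/
noncomputable def sivCoset (d : ℕ) (x : ℂ) : Finset ℂ :=
  (Polynomial.nthRootsFinset d (1 : ℂ)).image (fun z => z * x)

theorem siv_mem_coset {d : ℕ} (hd : 0 < d) {x y : ℂ} :
    y ∈ sivCoset d x ↔ ∃ z : ℂ, z ^ d = 1 ∧ z * x = y := by
  simp [sivCoset, siv_mem hd]

theorem siv_coset_stable {d : ℕ} (hd : 0 < d) (x : ℂ) : SivStable d (sivCoset d x) := by
  intro z hz y hy
  obtain ⟨w, hw, rfl⟩ := (siv_mem_coset hd).1 hy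
  exact (siv_mem_coset hd).2 ⟨z * w, by rw [mul_pow, hz, hw, one_mul], by ring⟩

theorem siv_coset_card {d : ℕ} (hd : 0 < d) {x : ℂ} (hx : x ≠ 0) : (sivCoset d x).card = d := by
  rw [sivCoset, Finset.card_image_of_injective _ (mul_left_injective₀ hx), siv_card d hd]

theorem siv_coset_sub {d m : ℕ} (hd : 0 < d) (hm : 0 < m) (hdm : d ∣ m) {x : ℂ} (hx : x ^ m = 1) :
    sivCoset d x ⊆ Polynomial.nthRootsFinset m (1 : ℂ) := by
  intro y hy
  obtain ⟨w, hw, rfl⟩ := (siv_mem_coset hd).1 hy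
  obtain ⟨k, rfl⟩ := hdm
  rw [siv_mem hm, mul_pow, hx, pow_mul, hw, one_pow, one_mul]

theorem siv_union {d : ℕ} {S T : Finset ℂ} (hS : SivStable d S) (hT : SivStable d T) :
    SivStable d (S ∪ T) := by
  intro z hz x hx
  rcases Finset.mem_union.1 hx with h | h
  · exact Finset.mem_union_left _ (hS z hz x h)
  · exact Finset.mem_union_right _ (hT z hz x h)

theorem siv_inv {d : ℕ} (hd : 0 < d) {z x : ℂ} (hz : z ^ d = 1) {S : Finset ℂ}
    (hS : SivStable d S) (h : z * x ∈ S) : x ∈ S := by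
  have hz0 : z ≠ 0 := by rintro rfl; simp [hd.ne'] at hz
  have := hS z⁻¹ (by rw [inv_pow, hz, inv_one]) _ h
  rwa [inv_mul_cancel_left₀ hz0] at this

theorem siv_sdiff {d : ℕ} (hd : 0 < d) {S T : Finset ℂ} (hS : SivStable d S)
    (hT : SivStable d T) : SivStable d (S \ T) := by
  intro z hz x hx
  rw [Finset.mem_sdiff] at hx ⊢
  exact ⟨hS z hz x hx.1, fun h => hx.2 (siv_inv hd hz hT h)⟩

theorem siv_mono {d e : ℕ} (hde : d ∣ e) {S : Finset ℂ} (hS : SivStable e S) : SivStable d S := by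
  intro z hz x hx
  obtain ⟨k, rfl⟩ := hde
  exact hS z (by rw [pow_mul, hz, one_pow]) x hx

theorem siv_choose {d : ℕ} (hd : 0 < d) {X : Finset ℂ} (hX : SivStable d X) (h0 : (0 : ℂ) ∉ X)
    (k : ℕ) (hk : k * d ≤ X.card) : ∃ S ⊆ X, SivStable d S ∧ S.card = k * d := by
  induction k with
  | zero => exact ⟨∅, by simp, by intro z _ x hx; simp at hx, by simp⟩
  | succ k ih =>
    obtain ⟨S, hSX, hS, hc⟩ := ih (by nlinarith)
    have hlt : S.card < X.card := by rw [hc]; nlinarith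
    obtain ⟨x, hx, hxS⟩ := Finset.exists_mem_notMem_of_card_lt_card hlt
    have hx0 : x ≠ 0 := by rintro rfl; exact h0 hx
    refine ⟨S ∪ sivCoset d x, ?_, siv_union hS (siv_coset_stable hd x), ?_⟩
    · apply Finset.union_subset hSX
      intro y hy
      obtain ⟨z, hz, rfl⟩ := (siv_mem_coset hd).1 hy
      exact hX z hz x hx
    · rw [Finset.card_union_of_disjoint, hc, siv_coset_card hd hx0]
      · ring
      · rw [Finset.disjoint_left]
        intro y hyS hy
        obtain ⟨z, hz, rfl⟩ := (siv_mem_coset hd).1 hy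
        exact hxS (siv_inv hd hz hS hyS)

theorem siv_full {m d : ℕ} (hm : 0 < m) (hdm : d ∣ m) :
    SivStable d (Polynomial.nthRootsFinset m (1 : ℂ)) := by
  apply siv_mono hdm
  intro z hz x hx
  rw [siv_mem hm] at hx ⊢
  rw [mul_pow, hz, hx, one_mul]

theorem siv_zero {m : ℕ} (hm : 0 < m) : (0 : ℂ) ∉ Polynomial.nthRootsFinset m (1 : ℂ) := by
  rw [siv_mem hm]; simp [hm.ne']

theorem siv_compl {m n : ℕ} (hm : 2 ≤ m) (h : SivV m n) : SivV m (m - n) := by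
  obtain ⟨S, hS, hc, hs⟩ := h
  refine ⟨Polynomial.nthRootsFinset m (1 : ℂ) \ S, Finset.sdiff_subset, ?_, ?_⟩
  · rw [Finset.card_sdiff_of_subset hS, siv_card m (by omega), hc]
  · have h1 := Finset.sum_sdiff (f := fun x : ℂ => x) hS
    have h2 := siv_sum hm (siv_full (m := m) (d := m) (by omega) dvd_rfl)
    simp only [hs, add_zero] at h1
    rw [h1, h2]

theorem siv_one {m p k : ℕ} (hm : 0 < m) (hp : 2 ≤ p) (hpm : p ∣ m) (hk : k * p ≤ m) :
    SivV m (k * p) := by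
  obtain ⟨S, hS, hst, hc⟩ := siv_choose (by omega) (siv_full hm hpm) (siv_zero hm) k
    (by rwa [siv_card m hm])
  exact ⟨S, hS, hc, siv_sum hp hst⟩

theorem siv_two {m p q a b c d : ℕ} (hm : 0 < m) (hp : p.Prime) (hq : q.Prime) (hpq : p ≠ q)
    (hpm : p ∣ m) (hqm : q ∣ m) (h : m = (a * p + b * q) + (c * p + d * q)) :
    SivV m (a * p + b * q) := by
  have hco : Nat.Coprime p q := (Nat.coprime_primes hp hq).2 hpq
  have hpqm : p * q ∣ m := hco.mul_dvd_of_dvd_of_dvd hpm hqm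
  have h' : m = (a + c) * p + (b + d) * q := by rw [h]; ring
  have hq1 : q ∣ a + c := by
    apply hco.symm.dvd_of_dvd_mul_right
    rw [h'] at hqm
    exact (Nat.dvd_add_left (Dvd.intro_left _ rfl)).1 hqm
  have hp1 : p ∣ b + d := by
    apply hco.dvd_of_dvd_mul_right
    rw [h'] at hpm
    exact (Nat.dvd_add_right (Dvd.intro_left _ rfl)).1 hpm
  obtain ⟨s, hs⟩ := hq1
  obtain ⟨t, ht⟩ := hp1
  have hmst : m = s * (p * q) + t * (p * q) := by rw [h', hs, ht]; ring
  have hpqpos : 0 < p * q := Nat.mul_pos hp.pos hq.pos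
  set U := Polynomial.nthRootsFinset m (1 : ℂ) with hU
  have hUc : U.card = m := siv_card m hm
  have hUs : SivStable (p * q) U := siv_full hm hpqm
  obtain ⟨X, hXU, hX, hXc⟩ := siv_choose hpqpos hUs (siv_zero hm) s (by rw [hUc]; omega)
  have hYc : (U \ X).card = t * (p * q) := by
    rw [Finset.card_sdiff_of_subset hXU, hUc, hXc]; omega
  have hY := siv_sdiff hpqpos hUs hX
  obtain ⟨A, hAX, hA, hAc⟩ := siv_choose hp.pos (siv_mono (Dvd.intro _ rfl) hX)
    (fun h => siv_zero hm (hXU h)) a (by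
      rw [hXc]; calc a * p ≤ (a + c) * p := by gcongr; omega
        _ = s * (p * q) := by rw [hs]; ring)
  obtain ⟨B, hBY, hB, hBc⟩ := siv_choose hq.pos (siv_mono (Dvd.intro_left _ rfl) hY)
    (fun h => siv_zero hm (Finset.sdiff_subset h)) b (by
      rw [hYc]; calc b * q ≤ (b + d) * q := by gcongr; omega
        _ = t * (p * q) := by rw [ht]; ring)
  have hdisj : Disjoint A B := Finset.disjoint_of_subset_left hAX
    (Finset.disjoint_of_subset_right hBY Finset.disjoint_sdiff)
  refine ⟨A ∪ B, Finset.union_subset (hAX.trans hXU) (hBY.trans Finset.sdiff_subset), ?_, ?_⟩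
  · rw [Finset.card_union_of_disjoint hdisj, hAc, hBc]
  · rw [Finset.sum_union hdisj, siv_sum hp.two_le hA, siv_sum hq.two_le hB, add_zero]

theorem siv_step {m p k : ℕ} (hm : 0 < m) (hp : p.Prime) (hpm : p ∣ m) (hk : p * k < m)
    (h : SivV m k) : SivV m (p + k) := by
  obtain ⟨S, hS, hc, hs⟩ := h
  have hlt : (S.biUnion (sivCoset p)).card < (Polynomial.nthRootsFinset m (1 : ℂ)).card := by
    rw [siv_card m hm]
    refine lt_of_le_of_lt (Finset.card_biUnion_le_card_mul S _ p ?_) (by rw [hc]; linarith)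
    intro x hx
    rw [siv_coset_card hp.pos]
    rintro rfl
    exact siv_zero hm (hS hx)
  obtain ⟨x, hx, hxS⟩ := Finset.exists_mem_notMem_of_card_lt_card hlt
  have hx0 : x ≠ 0 := by rintro rfl; exact siv_zero hm hx
  have hdisj : Disjoint (sivCoset p x) S := by
    rw [Finset.disjoint_left]
    intro y hy hyS
    apply hxS
    obtain ⟨z, hz, rfl⟩ := (siv_mem_coset hp.pos).1 hy
    refine Finset.mem_biUnion.2 ⟨_, hyS, ?_⟩
    exact siv_inv hp.pos hz (siv_coset_stable hp.pos _)
      ((siv_mem_coset hp.pos).2 ⟨1, one_pow _, one_mul _⟩)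
  refine ⟨sivCoset p x ∪ S,
    Finset.union_subset (siv_coset_sub hp.pos hm hpm ((siv_mem hm).1 hx)) hS, ?_, ?_⟩
  · rw [Finset.card_union_of_disjoint hdisj, hc, siv_coset_card hp.pos hx0]
  · rw [Finset.sum_union hdisj, hs, siv_sum hp.two_le (siv_coset_stable hp.pos x), add_zero]

theorem siv_greedy {m n : ℕ} (hm : 0 < m) (hlt : ∀ p ∈ m.primeFactors, p * n < m)
    (h : ∃ f : ℕ → ℕ, n = ∑ p ∈ m.primeFactors, f p * p) : SivV m n := by
  have hcl : n ∈ AddSubmonoid.closure (m.primeFactors : Set ℕ) := by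
    obtain ⟨f, hf⟩ := h
    rw [hf]
    apply AddSubmonoid.sum_mem
    intro p hp
    rw [← smul_eq_mul]
    exact AddSubmonoid.nsmul_mem _ (AddSubmonoid.subset_closure hp) _
  have key : ∀ k ∈ AddSubmonoid.closure (m.primeFactors : Set ℕ), k ≤ n → SivV m k := by
    intro k hk
    induction hk using AddSubmonoid.closure_induction_left with
    | zero => exact fun _ => ⟨∅, by simp, by simp, by simp⟩
    | add_left p hp k _ ih =>
      intro hle
      have hp' : p ∈ m.primeFactors := hp
      refine siv_step hm (Nat.prime_of_mem_primeFactors hp') (Nat.dvd_of_mem_primeFactors hp') ?_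
        (ih (by omega))
      exact lt_of_le_of_lt (Nat.mul_le_mul_left p (by omega)) (hlt p hp')
  exact key n hcl le_rfl

theorem siv_frob {p q n : ℕ} (hp : 0 < p) (hq : 0 < q) (hco : Nat.Coprime p q) (hn : p * q ≤ n) :
    ∃ a b : ℕ, n = a * p + b * q := by
  obtain ⟨a, b, h⟩ := Nat.exists_add_mul_eq_of_gcd_dvd_of_mul_pred_le p q n
    (by rw [hco.gcd_eq_one]; exact one_dvd n)
    ((Nat.mul_le_mul (Nat.pred_le p) (Nat.pred_le q)).trans hn)
  exact ⟨a, b, h.symm⟩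

theorem siv_three {m n p q : ℕ} (hm : 0 < m) (hp : p ∈ m.primeFactors) (hq : q ∈ m.primeFactors)
    (hpq : p < q) (hmin : ∀ r ∈ m.primeFactors, r ≠ p → r ≠ q → q < r)
    (hex : ∃ r ∈ m.primeFactors, r ≠ p ∧ r ≠ q) (hn : n ≤ m - n) 
    (h : ∃ f : ℕ → ℕ, n = ∑ p ∈ m.primeFactors, f p * p) : SivV m n := by
  have hpp := Nat.prime_of_mem_primeFactors hp
  have hqp := Nat.prime_of_mem_primeFactors hq
  have hpm := Nat.dvd_of_mem_primeFactors hp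
  have hqm := Nat.dvd_of_mem_primeFactors hq
  have hco : Nat.Coprime p q := (Nat.coprime_primes hpp hqp).2 hpq.ne
  rcases le_or_gt (p * q) n with hle | hlt
  · obtain ⟨a, b, hab⟩ := siv_frob hpp.pos hqp.pos hco hle
    obtain ⟨c, d, hcd⟩ := siv_frob hpp.pos hqp.pos hco (hle.trans hn)
    rw [hab]
    exact siv_two (c := c) (d := d) hm hpp hqp hpq.ne hpm hqm (by rw [← hcd, ← hab]; omega)
  · have key : ∀ r ∈ m.primeFactors, r ≠ p → r ≠ q → r * n < m := by
      intro r hr h1 h2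
      have hrp := Nat.prime_of_mem_primeFactors hr
      have hdvd : r * (p * q) ∣ m := by
        apply Nat.Coprime.mul_dvd_of_dvd_of_dvd _ (Nat.dvd_of_mem_primeFactors hr)
          (hco.mul_dvd_of_dvd_of_dvd hpm hqm)
        exact Nat.Coprime.mul_right ((Nat.coprime_primes hrp hpp).2 h1)
          ((Nat.coprime_primes hrp hqp).2 h2)
      exact lt_of_lt_of_le (Nat.mul_lt_mul_of_pos_left hlt hrp.pos) (Nat.le_of_dvd hm hdvd)
    obtain ⟨r, hr, hr1, hr2⟩ := hex
    have hqr := hmin r hr hr1 hr2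
    have hrn := key r hr hr1 hr2
    apply siv_greedy hm _ h
    intro s hs
    by_cases h1 : s = p
    · subst h1
      exact lt_of_le_of_lt (Nat.mul_le_mul_right n (by omega)) hrn
    by_cases h2 : s = q
    · subst h2
      exact lt_of_le_of_lt (Nat.mul_le_mul_right n (by omega)) hrn
    exact key s hs h1 h2

theorem siv_main {m n : ℕ} (hm : 2 ≤ m) (hnm : n ≤ m)
    (h1 : ∃ f : ℕ → ℕ, n = ∑ p ∈ m.primeFactors, f p * p)
    (h2 : ∃ g : ℕ → ℕ, m - n = ∑ p ∈ m.primeFactors, g p * p) : SivV m n := by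
  have hm0 : 0 < m := by omega
  have hne : m.primeFactors.Nonempty := Nat.nonempty_primeFactors.2 (by omega)
  set p := m.primeFactors.min' hne with hpdef
  have hp : p ∈ m.primeFactors := Finset.min'_mem _ _
  have hpp := Nat.prime_of_mem_primeFactors hp
  have hpm := Nat.dvd_of_mem_primeFactors hp
  rcases (m.primeFactors.erase p).eq_empty_or_nonempty with he | hne2
  · have hs : m.primeFactors = {p} := by
      rw [← Finset.insert_erase hp, he]; rfl
    obtain ⟨f, hf⟩ := h1
    rw [hs, Finset.sum_singleton] at hf
    rw [hf]
    exact siv_one hm0 hpp.two_le hpm (by omega)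
  set q := (m.primeFactors.erase p).min' hne2 with hqdef
  have hq' : q ∈ m.primeFactors.erase p := Finset.min'_mem _ _
  have hq := Finset.mem_of_mem_erase hq'
  have hqp' : q ≠ p := Finset.ne_of_mem_erase hq'
  have hqp := Nat.prime_of_mem_primeFactors hq
  have hqm := Nat.dvd_of_mem_primeFactors hq
  have hlt : p < q := lt_of_le_of_ne (Finset.min'_le _ _ hq) hqp'.symm
  by_cases hex : ∃ r ∈ m.primeFactors, r ≠ p ∧ r ≠ q
  · have hmin : ∀ r ∈ m.primeFactors, r ≠ p → r ≠ q → q < r := by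
      intro r hr hr1 hr2
      exact lt_of_le_of_ne (Finset.min'_le _ _ (Finset.mem_erase.2 ⟨hr1, hr⟩)) hr2.symm
    rcases le_total n (m - n) with hle | hle
    · exact siv_three hm0 hp hq hlt hmin hex hle h1
    · have := siv_compl hm (siv_three hm0 hp hq hlt hmin hex (n := m - n) (by omega) h2)
      rwa [Nat.sub_sub_self hnm] at this
  · have hs : m.primeFactors = {p, q} := by
      ext r
      simp only [Finset.mem_insert, Finset.mem_singleton]
      constructor
      · intro hr
        by_contra hc
        push Not at hc
        exact hex ⟨r, hr, hc⟩
      · rintro (h | h)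
        · rw [h]; exact hp
        · rw [h]; exact hq
    obtain ⟨f, hf⟩ := h1
    obtain ⟨g, hg⟩ := h2
    rw [hs, Finset.sum_pair hlt.ne] at hf hg
    rw [hf]
    exact siv_two (c := g p) (d := g q) hm0 hpp hqp hlt.ne hpm hqm (by omega)

theorem sivek_sufficiency (m n : ℕ) (hm : 2 ≤ m) (hn : 2 ≤ n) (hnm : n ≤ m)
    (h1 : ∃ f : ℕ → ℕ, n = ∑ p ∈ m.primeFactors, f p * p)
    (h2 : ∃ g : ℕ → ℕ, m - n = ∑ p ∈ m.primeFactors, g p * p) :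
    ∃ x : Fin n → ℂ, Function.Injective x ∧ (∀ i, x i ^ m = 1) ∧ ∑ i, x i = 0 := by
  obtain ⟨S, hS, hc, hs⟩ := siv_main hm hnm h1 h2
  let e : Fin n ≃ S := (S.equivFinOfCardEq hc).symm
  refine ⟨fun i => (e i : ℂ), fun i j h => e.injective (Subtype.ext h), fun i => ?_, ?_⟩
  · exact (siv_mem (by omega)).1 (hS (e i).2)
  · rw [Equiv.sum_comp e (fun x : S => (x : ℂ)), Finset.sum_coe_sort S (fun x => x), hs]
end

section
/- If n distinct m-th roots of unity sum to 0 (with 2 ≤ n ≤ m), then both n and m − n are expressible as non-negative integer combinations of the prime divisors of m. -/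
open IntermediateField
def SS (m : ℕ) : AddSubmonoid (ℂ × ℕ) := AddSubmonoid.closure {x | x.1 ^ m = 1 ∧ x.2 = 1}

lemma SS_zero {m : ℕ} {x : ℂ × ℕ} (h : x ∈ SS m) : x.2 = 0 → x.1 = 0 := by
  induction h using AddSubmonoid.closure_induction with
  | mem x hx => intro h; have := hx.2; omega
  | zero => simp
  | add x y _ _ hx hy =>
    intro h
    have h' : x.2 + y.2 = 0 := h
    simp [hx (by omega), hy (by omega)]

lemma SS_one {x : ℂ × ℕ} (h : x ∈ SS 1) : x.1 = x.2 := by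
  induction h using AddSubmonoid.closure_induction with
  | mem x hx => obtain ⟨h1, h2⟩ := hx; simp at h1; simp [h1, h2]
  | zero => simp
  | add x y _ _ hx hy => simp [hx, hy]

lemma SS_field {m : ℕ} {K : IntermediateField ℚ ℂ} (hK : ∀ z : ℂ, z ^ m = 1 → z ∈ K)
    {x : ℂ × ℕ} (h : x ∈ SS m) : x.1 ∈ K := by
  induction h using AddSubmonoid.closure_induction with
  | mem x hx => exact hK _ hx.1
  | zero => exact K.zero_mem
  | add x y _ _ hx hy => exact K.add_mem hx hy

/-- decomposition along cosets -/
lemma SS_decomp {m q : ℕ} {ω : ℂ}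
    (hω : ∀ z : ℂ, z ^ (q * m) = 1 → ∃ i < q, ∃ y : ℂ, y ^ m = 1 ∧ z = ω ^ i * y)
    {x : ℂ × ℕ} (h : x ∈ SS (q * m)) :
    ∃ f : ℕ → ℂ × ℕ, (∀ i, f i ∈ SS m) ∧ x.1 = ∑ i ∈ Finset.range q, (f i).1 * ω ^ i ∧
      x.2 = ∑ i ∈ Finset.range q, (f i).2 := by
  induction h using AddSubmonoid.closure_induction with
  | mem x hx =>
    obtain ⟨h1, h2⟩ := hx
    obtain ⟨i, hi, y, hy, hz⟩ := hω _ h1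
    refine ⟨fun j => if j = i then (y, 1) else 0, ?_, ?_, ?_⟩
    · intro j
      dsimp only
      split_ifs
      · exact AddSubmonoid.subset_closure ⟨hy, rfl⟩
      · exact zero_mem _
    · simp [apply_ite Prod.fst, hi, hz, mul_comm]
    · simp [apply_ite Prod.snd, hi, h2]
  | zero => exact ⟨0, fun _ => zero_mem _, by simp, by simp⟩
  | add x y _ _ hx hy =>
    obtain ⟨f, f1, f2, f3⟩ := hx
    obtain ⟨g, g1, g2, g3⟩ := hy
    refine ⟨f + g, fun i => add_mem (f1 i) (g1 i), ?_, ?_⟩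
    · simp [f2, g2, add_mul, Finset.sum_add_distrib]
    · simp [f3, g3, Finset.sum_add_distrib]

lemma finrank_cyc {m : ℕ} (hm : 0 < m) {ζ : ℂ} (h : IsPrimitiveRoot ζ m) :
    Module.finrank ℚ ℚ⟮ζ⟯ = m.totient := by
  rw [IntermediateField.adjoin.finrank, ← Polynomial.cyclotomic_eq_minpoly_rat h hm,
    Polynomial.natDegree_cyclotomic]
  exact (h.isIntegral hm).tower_top

lemma indep {m N d : ℕ} (hm : 0 < m) (hN : 0 < N) {ζ ω ξ : ℂ} (hζ : IsPrimitiveRoot ζ m)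
    (hξ : IsPrimitiveRoot ξ N) (hω : IsIntegral ℚ ω) (hmem : ξ ∈ (ℚ⟮ζ⟯)⟮ω⟯)
    (hd : d * m.totient ≤ N.totient) (c : ℕ → ℂ) (hc : ∀ i, c i ∈ ℚ⟮ζ⟯)
    (hs : ∑ i ∈ Finset.range d, c i * ω ^ i = 0) : ∀ i < d, c i = 0 := by
  have hωK : IsIntegral ℚ⟮ζ⟯ ω := hω.tower_top
  have hdeg : d ≤ (minpoly ℚ⟮ζ⟯ ω).natDegree := by
    rw [← IntermediateField.adjoin.finrank hωK]
    have h1 := Module.finrank_mul_finrank ℚ ℚ⟮ζ⟯ (ℚ⟮ζ⟯)⟮ω⟯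
    rw [finrank_cyc hm hζ] at h1
    have : FiniteDimensional ℚ⟮ζ⟯ (ℚ⟮ζ⟯)⟮ω⟯ := IntermediateField.adjoin.finiteDimensional hωK
    have : FiniteDimensional ℚ ℚ⟮ζ⟯ :=
      IntermediateField.adjoin.finiteDimensional ((hζ.isIntegral hm).tower_top)
    have : FiniteDimensional ℚ (ℚ⟮ζ⟯)⟮ω⟯ := FiniteDimensional.trans ℚ ℚ⟮ζ⟯ _
    have h2 : ℚ⟮ξ⟯ ≤ ((ℚ⟮ζ⟯)⟮ω⟯).restrictScalars ℚ := by
      rw [IntermediateField.adjoin_simple_le_iff]; exact hmem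
    have h3 : Module.finrank ℚ ℚ⟮ξ⟯ ≤ Module.finrank ℚ (ℚ⟮ζ⟯)⟮ω⟯ :=
      LinearMap.finrank_le_finrank_of_injective
        (f := (IntermediateField.inclusion h2).toLinearMap)
        (IntermediateField.inclusion_injective h2)
    rw [finrank_cyc hN hξ, ← h1] at h3
    have := hd.trans h3
    rw [mul_comm] at this
    exact Nat.le_of_mul_le_mul_left this (Nat.totient_pos.2 hm)
  let P : Polynomial ℚ⟮ζ⟯ := ∑ i ∈ Finset.range d, Polynomial.monomial i ⟨c i, hc i⟩
  have hcoef : ∀ i, P.coeff i = if i < d then ⟨c i, hc i⟩ else 0 := by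
    intro i
    simp [P, Polynomial.coeff_monomial]
  have hP0 : P = 0 := by
    by_contra hne
    have h1 : P.degree < d := by
      rw [Polynomial.degree_lt_iff_coeff_zero]
      intro i hi
      rw [hcoef, if_neg (by omega)]
    have h2 : Polynomial.aeval ω P = 0 := by
      simp only [P, map_sum, Polynomial.aeval_monomial]
      exact hs
    have h3 := minpoly.degree_le_of_ne_zero ℚ⟮ζ⟯ ω hne h2
    rw [Polynomial.degree_eq_natDegree (minpoly.ne_zero hωK)] at h3
    have h4 := h3.trans_lt h1
    have h5 : (minpoly ℚ⟮ζ⟯ ω).natDegree < d := by exact_mod_cast h4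
    omega
  intro i hi
  have h := hcoef i
  rw [hP0, if_pos hi, Polynomial.coeff_zero] at h
  exact (congrArg Subtype.val h).symm

lemma roots_mem {m : ℕ} (hm : 0 < m) {ζ : ℂ} (hζ : IsPrimitiveRoot ζ m) (z : ℂ) (hz : z ^ m = 1) :
    z ∈ ℚ⟮ζ⟯ := by
  have : NeZero m := ⟨hm.ne'⟩
  obtain ⟨i, _, rfl⟩ := hζ.eq_pow_of_pow_eq_one hz
  exact pow_mem (IntermediateField.mem_adjoin_simple_self ℚ ζ) i

lemma step_dvd {m q : ℕ} (hm : 0 < m) (hq : q.Prime) (hqm : q ∣ m) :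
    ∃ ω : ℂ, (∀ z : ℂ, z ^ (q * m) = 1 → ∃ i < q, ∃ y : ℂ, y ^ m = 1 ∧ z = ω ^ i * y) ∧
      ∀ f g : ℕ → ℂ × ℕ, (∀ i, f i ∈ SS m) → (∀ i, g i ∈ SS m) →
        ∑ i ∈ Finset.range q, (f i).1 * ω ^ i = ∑ i ∈ Finset.range q, (g i).1 * ω ^ i →
        ∀ i < q, (f i).1 = (g i).1 := by
  have hpos : 0 < q * m := Nat.mul_pos hq.pos hm
  have : NeZero (q * m) := ⟨hpos.ne'⟩
  have hω := Complex.isPrimitiveRoot_exp (q * m) hpos.ne'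
  set ω := Complex.exp (2 * Real.pi * Complex.I / ((q * m : ℕ) : ℂ))
  have hζ : IsPrimitiveRoot (ω ^ q) m := hω.pow hpos rfl
  refine ⟨ω, ?_, ?_⟩
  · intro z hz
    obtain ⟨t, _, rfl⟩ := hω.eq_pow_of_pow_eq_one hz
    refine ⟨t % q, Nat.mod_lt _ hq.pos, (ω ^ q) ^ (t / q), ?_, ?_⟩
    · rw [← pow_mul, mul_comm, pow_mul, hζ.pow_eq_one, one_pow]
    · rw [← pow_mul, ← pow_add, Nat.mod_add_div]
  · intro f g hf hg h i hi
    refine sub_eq_zero.1 (indep hm hpos hζ hω (hω.isIntegral hpos).tower_top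
      (IntermediateField.mem_adjoin_simple_self _ ω) (d := q) ?_
      (fun i => (f i).1 - (g i).1) ?_ ?_ i hi)
    · rw [Nat.totient_mul_of_prime_of_dvd hq hqm]
    · intro i
      exact sub_mem (SS_field (roots_mem hm hζ) (hf i)) (SS_field (roots_mem hm hζ) (hg i))
    · simp only [sub_mul, Finset.sum_sub_distrib, h, sub_self]

lemma step_cop {m q : ℕ} (hm : 0 < m) (hq : q.Prime) (hqm : ¬ q ∣ m) :
    ∃ ω : ℂ, (∀ z : ℂ, z ^ (q * m) = 1 → ∃ i < q, ∃ y : ℂ, y ^ m = 1 ∧ z = ω ^ i * y) ∧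
      ∀ f g : ℕ → ℂ × ℕ, (∀ i, f i ∈ SS m) → (∀ i, g i ∈ SS m) →
        ∑ i ∈ Finset.range q, (f i).1 * ω ^ i = ∑ i ∈ Finset.range q, (g i).1 * ω ^ i →
        ∀ i < q, ∀ j < q, (f i).1 + (g j).1 = (f j).1 + (g i).1 := by
  have hpos : 0 < q * m := Nat.mul_pos hq.pos hm
  have : NeZero (q * m) := ⟨hpos.ne'⟩
  have hω := Complex.isPrimitiveRoot_exp q hq.ne_zero
  set ω := Complex.exp (2 * Real.pi * Complex.I / (q : ℂ))
  have hζ := Complex.isPrimitiveRoot_exp m hm.ne'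
  set ζ := Complex.exp (2 * Real.pi * Complex.I / (m : ℂ))
  have hcop : q.Coprime m := (Nat.Prime.coprime_iff_not_dvd hq).2 hqm
  have hξ : IsPrimitiveRoot (ω * ζ) (q * m) := by
    have h := (Commute.all ω ζ).orderOf_mul_eq_mul_orderOf_of_coprime
      (by rwa [← hω.eq_orderOf, ← hζ.eq_orderOf])
    rw [← hω.eq_orderOf, ← hζ.eq_orderOf] at h
    rw [← h]
    exact IsPrimitiveRoot.orderOf _
  refine ⟨ω, ?_, ?_⟩
  · intro z hz
    obtain ⟨t, _, rfl⟩ := hξ.eq_pow_of_pow_eq_one hz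
    refine ⟨t % q, Nat.mod_lt _ hq.pos, ζ ^ t, ?_, ?_⟩
    · rw [← pow_mul, mul_comm, pow_mul, hζ.pow_eq_one, one_pow]
    · rw [mul_pow]
      congr 1
      conv_lhs => rw [← Nat.mod_add_div t q, pow_add, pow_mul, hω.pow_eq_one, one_pow, mul_one]
  · intro f g hf hg h
    have hK : ∀ i, (f i).1 - (g i).1 ∈ ℚ⟮ζ⟯ := fun i =>
      sub_mem (SS_field (roots_mem hm hζ) (hf i)) (SS_field (roots_mem hm hζ) (hg i))
    have key : ∀ i < q - 1,
        ((f i).1 - (g i).1) - ((f (q-1)).1 - (g (q-1)).1) = 0 := by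
      refine indep hm hpos hζ hξ (ω := ω) (hω.isIntegral hq.pos).tower_top ?_ (d := q - 1) ?_
        (fun i => ((f i).1 - (g i).1) - ((f (q-1)).1 - (g (q-1)).1)) ?_ ?_
      · exact mul_mem (IntermediateField.mem_adjoin_simple_self _ ω)
          ((ℚ⟮ζ⟯⟮ω⟯).algebraMap_mem ⟨ζ, IntermediateField.mem_adjoin_simple_self ℚ ζ⟩)
      · rw [Nat.totient_mul hcop, Nat.totient_prime hq]
      · intro i
        exact sub_mem (hK _) (hK _)
      · have h0 := hω.geom_sum_eq_zero hq.one_lt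
        have h1 : ∑ i ∈ Finset.range (q - 1 + 1),
            (((f i).1 - (g i).1) - ((f (q-1)).1 - (g (q-1)).1)) * ω ^ i = 0 := by
          rw [Nat.sub_add_cancel hq.one_le]
          simp only [sub_mul, Finset.sum_sub_distrib, h, sub_self, ← Finset.mul_sum, h0, mul_zero]
        rw [Finset.sum_range_succ] at h1
        simpa using h1
    have key' : ∀ i < q, (f i).1 - (g i).1 = (f (q-1)).1 - (g (q-1)).1 := by
      intro i hi
      rcases Nat.lt_or_ge i (q - 1) with h | h
      · exact sub_eq_zero.1 (key i h)
      · rw [show i = q - 1 by omega]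
    intro i hi j hj
    have := (key' i hi).trans (key' j hj).symm
    linear_combination this

/-- the main inductive claim -/
def Claim (H : AddSubmonoid ℕ) (p r m : ℕ) : Prop :=
  ∀ (v : ℂ) (k l : ℕ), (v, k) ∈ SS m → (v, l) ∈ SS m → k < p →
    (∃ h ∈ H, l = k + h) ∨ (p - k) * (r - 1) ≤ l

lemma sum_H {H : AddSubmonoid ℕ} {q : ℕ} {k l : ℕ → ℕ}
    (h : ∀ i < q, ∃ h ∈ H, l i = k i + h) :
    ∃ h ∈ H, ∑ i ∈ Finset.range q, l i = ∑ i ∈ Finset.range q, k i + h := by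
  choose! e he1 he2 using h
  refine ⟨∑ i ∈ Finset.range q, e i, sum_mem fun i hi => he1 i (Finset.mem_range.1 hi), ?_⟩
  rw [← Finset.sum_add_distrib]
  exact Finset.sum_congr rfl fun i hi => he2 i (Finset.mem_range.1 hi)

lemma claim_dvd {H : AddSubmonoid ℕ} {p r m q : ℕ} (hm : 0 < m) (hq : q.Prime) (hqm : q ∣ m)
    (hC : Claim H p r m) : Claim H p r (q * m) := by
  intro v k l hk hl hkp
  obtain ⟨ω, h1, h2⟩ := step_dvd hm hq hqm
  obtain ⟨f, f1, f2, f3⟩ := SS_decomp h1 hk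
  obtain ⟨g, g1, g2, g3⟩ := SS_decomp h1 hl
  dsimp only at f2 f3 g2 g3
  have heq := h2 f g f1 g1 (f2.symm.trans g2)
  have hle : ∀ i < q, (f i).2 ≤ k := fun i hi => by
    rw [f3]
    exact Finset.single_le_sum (f := fun i => (f i).2) (fun _ _ => Nat.zero_le _)
      (Finset.mem_range.2 hi)
  have hle' : ∀ i < q, (g i).2 ≤ l := fun i hi => by
    rw [g3]
    exact Finset.single_le_sum (f := fun i => (g i).2) (fun _ _ => Nat.zero_le _)
      (Finset.mem_range.2 hi)
  by_cases hall : ∀ i < q, ∃ h ∈ H, (g i).2 = (f i).2 + h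
  · left
    rw [f3, g3]
    exact sum_H hall
  · right
    push Not at hall
    obtain ⟨i, hi, hn⟩ := hall
    rcases hC (f i).1 (f i).2 (g i).2 (f1 i) (by rw [heq i hi]; exact g1 i)
      ((hle i hi).trans_lt hkp) with ⟨h, hH, e⟩ | h
    · exact absurd e (hn h hH)
    · refine le_trans (Nat.mul_le_mul_right _ ?_) (h.trans (hle' i hi))
      have := hle i hi
      omega

lemma exists_min_zero {q k : ℕ} {a b : ℕ → ℕ} (hk : k = ∑ i ∈ Finset.range q, a i) (hkq : k < q) :
    ∃ j < q, a j = 0 ∧ ∀ i < q, a i = 0 → b j ≤ b i := by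
  have hne : ((Finset.range q).filter (fun i => a i = 0)).Nonempty := by
    by_contra hcon
    rw [Finset.not_nonempty_iff_eq_empty, Finset.filter_eq_empty_iff] at hcon
    have : ∑ i ∈ Finset.range q, 1 ≤ ∑ i ∈ Finset.range q, a i :=
      Finset.sum_le_sum fun i hi => Nat.one_le_iff_ne_zero.2 (hcon hi)
    simp at this
    omega
  obtain ⟨j, hj, hmin⟩ := Finset.exists_min_image _ b hne
  simp only [Finset.mem_filter, Finset.mem_range] at hj hmin
  exact ⟨j, hj.1, hj.2, fun i hi hi' => hmin i ⟨hi, hi'⟩⟩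

lemma claim_prime {H : AddSubmonoid ℕ} {p r : ℕ} (hp : p.Prime) (hpH : p ∈ H) :
    Claim H p r p := by
  intro v k l hk hl hkp
  left
  obtain ⟨ω, h1, h2⟩ := step_cop one_pos hp (by simpa using hp.one_lt.ne')
  rw [← mul_one p] at hk hl
  obtain ⟨f, f1, f2, f3⟩ := SS_decomp h1 hk
  obtain ⟨g, g1, g2, g3⟩ := SS_decomp h1 hl
  dsimp only at f2 f3 g2 g3
  have heq := h2 f g f1 g1 (f2.symm.trans g2)
  obtain ⟨j, hj, hj0, -⟩ := exists_min_zero (b := 0) f3 hkp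
  refine ⟨p * (g j).2, ?_, ?_⟩
  · rw [mul_comm, ← smul_eq_mul]; exact nsmul_mem hpH _
  · have : ∀ i < p, (g i).2 = (f i).2 + (g j).2 := by
      intro i hi
      have h := heq i hi j hj
      rw [SS_one (f1 i), SS_one (g1 j), SS_one (f1 j), SS_one (g1 i), hj0] at h
      norm_cast at h
      omega
    rw [g3, Finset.sum_congr rfl fun i hi => this i (Finset.mem_range.1 hi),
      Finset.sum_add_distrib, ← f3]
    simp

lemma ineq {p r q k ki l li l0 : ℕ} (hpr : p < r) (hrq : r ≤ q) (hkp : k < p) (hki : ki ≤ k)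
    (hl : (q - 1) * l0 + li ≤ l + (k - ki) * l0)
    (h : p ≤ ki + l0 ∨ (p - (ki + l0)) * (r - 1) ≤ li) : (p - k) * (r - 1) ≤ l := by
  obtain ⟨d, rfl⟩ := Nat.exists_eq_add_of_le hki
  obtain ⟨s, rfl⟩ := Nat.exists_eq_add_of_lt hkp
  obtain ⟨t, rfl⟩ := Nat.exists_eq_add_of_lt hpr
  obtain ⟨u, rfl⟩ := Nat.exists_eq_add_of_le hrq
  rw [show ki + d - ki = d by omega] at hl
  rw [show ki + d + s + 1 + t + 1 + u - 1 = ki + d + s + 1 + t + u by omega] at hl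
  rw [show ki + d + s + 1 + t + 1 - 1 = ki + d + s + 1 + t by omega] at h ⊢
  rw [show ki + d + s + 1 - (ki + d) = s + 1 by omega]
  by_cases hc : ki + d + s + 1 ≤ ki + l0
  · obtain ⟨e, rfl⟩ := Nat.exists_eq_add_of_le (show d + s + 1 ≤ l0 by omega)
    nlinarith [Nat.zero_le (d * t), Nat.zero_le (d * ki), Nat.zero_le (u * (d + s + 1 + e)), Nat.zero_le (e * (ki + s + 1 + t))]
  · have h' := h.resolve_left hc
    obtain ⟨e, he⟩ := Nat.exists_eq_add_of_le (show l0 ≤ d + s + 1 by omega)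
    rw [show ki + d + s + 1 - (ki + l0) = e by omega] at h'
    have hu := Nat.zero_le (u * l0)
    have hA : d * l0 ≤ d * (ki + d + s + 1 + t) := Nat.mul_le_mul_left _ (by omega)
    have hB : (l0 + e) * (ki + d + s + 1 + t) = (d + s + 1) * (ki + d + s + 1 + t) := by rw [he]
    nlinarith

lemma claim_cop {H : AddSubmonoid ℕ} {p r m q : ℕ} (hm : 0 < m) (hq : q.Prime) (hqm : ¬ q ∣ m)
    (hqH : q ∈ H) (hpr : p < r) (hrq : r ≤ q)
    (hC : Claim H p r m) : Claim H p r (q * m) := by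
  intro v k l hk hl hkp
  obtain ⟨ω, h1, h2⟩ := step_cop hm hq hqm
  obtain ⟨f, f1, f2, f3⟩ := SS_decomp h1 hk
  obtain ⟨g, g1, g2, g3⟩ := SS_decomp h1 hl
  dsimp only at f2 f3 g2 g3
  have heq := h2 f g f1 g1 (f2.symm.trans g2)
  obtain ⟨j, hj, hj0, hjmin⟩ := exists_min_zero (b := fun i => (g i).2) f3 (by omega)
  have heq' : ∀ i < q, (f i).1 + (g j).1 = (g i).1 := by
    intro i hi
    rw [heq i hi j hj, SS_zero (f1 j) hj0, zero_add]
  by_cases hall : ∀ i < q, ∃ h ∈ H, (g i).2 = ((f i).2 + (g j).2) + h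
  · left
    obtain ⟨h, hH, e⟩ := sum_H hall
    refine ⟨q * (g j).2 + h, add_mem ?_ hH, ?_⟩
    · rw [mul_comm, ← smul_eq_mul]; exact nsmul_mem hqH _
    · rw [g3, e, Finset.sum_add_distrib, ← f3]
      simp [add_assoc]
  · right
    push Not at hall
    obtain ⟨i, hi, hn⟩ := hall
    have hi' := Finset.mem_range.2 hi
    have hf := Finset.add_sum_erase _ (fun i => (f i).2) hi'
    have hg := Finset.add_sum_erase _ (fun i => (g i).2) hi'
    rw [← f3] at hf
    rw [← g3] at hg
    have hs : ∑ x ∈ (Finset.range q).erase i, (g j).2 ≤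
        ∑ x ∈ (Finset.range q).erase i, ((g x).2 + (f x).2 * (g j).2) := by
      refine Finset.sum_le_sum fun x hx => ?_
      have hx' := Finset.mem_range.1 (Finset.mem_of_mem_erase hx)
      rcases Nat.eq_zero_or_pos (f x).2 with h0 | h0
      · exact (hjmin x hx' h0).trans (Nat.le_add_right _ _)
      · exact (Nat.le_mul_of_pos_left _ h0).trans (Nat.le_add_left _ _)
    rw [Finset.sum_const, Finset.card_erase_of_mem hi', Finset.card_range, smul_eq_mul,
      Finset.sum_add_distrib, ← Finset.sum_mul] at hs
    refine ineq (ki := (f i).2) (li := (g i).2) (l0 := (g j).2) hpr hrq hkp (by omega) ?_ ?_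
    · rw [show k - (f i).2 = ∑ x ∈ (Finset.range q).erase i, (f x).2 by omega]
      omega
    · by_cases hc : p ≤ (f i).2 + (g j).2
      · exact Or.inl hc
      · right
        rcases hC (g i).1 ((f i).2 + (g j).2) (g i).2
          (by rw [← heq' i hi]; exact add_mem (f1 i) (g1 j)) (g1 i) (by omega) with ⟨h, hH, e⟩ | h
        · exact absurd e (hn h hH)
        · exact h

lemma claim_all {H : AddSubmonoid ℕ} {p r : ℕ} (hp : p.Prime) (hpH : p ∈ H) (hpr : p < r) (c : ℕ) :
    c ≠ 0 → (∀ q, q.Prime → q ∣ c → q ∈ H ∧ (q = p ∨ r ≤ q)) → Claim H p r (p * c) := by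
  induction c using induction_on_primes with
  | zero => intro h; exact absurd rfl h
  | one => intro _ _; rw [mul_one]; exact claim_prime hp hpH
  | prime_mul q a hq ih =>
    intro h0 h
    have ha : a ≠ 0 := right_ne_zero_of_mul h0
    have hC := ih ha fun q' hq' hd => h q' hq' (hd.mul_left _)
    have hpos : 0 < p * a := Nat.mul_pos hp.pos (Nat.pos_of_ne_zero ha)
    rw [show p * (q * a) = q * (p * a) by ring]
    by_cases hd : q ∣ p * a
    · exact claim_dvd hpos hq hd hC
    · obtain ⟨h1, h2⟩ := h q hq (dvd_mul_right _ _)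
      refine claim_cop hpos hq hd h1 hpr (h2.resolve_left ?_) hC
      rintro rfl
      exact hd (dvd_mul_right _ _)

lemma lam_leung_s12 {H : AddSubmonoid ℕ} {m n : ℕ} (hm : 2 ≤ m) (hH : ∀ q, q.Prime → q ∣ m → q ∈ H)
    (h : ((0 : ℂ), n) ∈ SS m) : n ∈ H := by
  have hp : m.minFac.Prime := Nat.minFac_prime (by omega)
  have hpm := m.minFac_dvd
  have hmin : ∀ q, q.Prime → q ∣ m → m.minFac ≤ q := fun q hq hd => Nat.minFac_le_of_dvd hq.two_le hd
  generalize m.minFac = p at hp hpm hmin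
  have hpH := hH p hp hpm
  obtain ⟨c, rfl⟩ := hpm
  have hc : c ≠ 0 := by rintro rfl; simp at hm
  have main : ∀ r, p < r → (∀ q, q.Prime → q ∣ p * c → q = p ∨ r ≤ q) →
      n ∈ H ∨ p * (r - 1) ≤ n := by
    intro r hpr hr
    have := claim_all hp hpH hpr c hc
      (fun q hq hd => ⟨hH q hq (hd.mul_left _), hr q hq (hd.mul_left _)⟩) 0 0 n (zero_mem _) h hp.pos
    simpa using this
  by_cases hex : ∃ q, q.Prime ∧ q ∣ p * c ∧ q ≠ p
  · classical
    obtain ⟨h1, h2, h3⟩ := Nat.find_spec hex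
    have hr := fun q hq hd (hne : q ≠ p) => Nat.find_min' hex ⟨hq, hd, hne⟩
    generalize Nat.find hex = r at h1 h2 h3 hr
    have hpr : p < r := lt_of_le_of_ne (hmin r h1 h2) h3.symm
    rcases main r hpr (fun q hq hd => or_iff_not_imp_left.2 (hr q hq hd)) with h | h
    · exact h
    · have hF := frobeniusNumber_pair ((Nat.coprime_primes hp h1).2 h3.symm) hp.one_lt h1.one_lt
      have hmem := (frobeniusNumber_iff.1 hF).2 n (by
        have : p * (r - 1) = p * r - p := by rw [Nat.mul_sub, mul_one]
        have h5 : 0 < p * (r - 1) := Nat.mul_pos hp.pos (by have := h1.two_le; omega)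
        have := h1.pos
        omega)
      refine (AddSubmonoid.closure_le.2 ?_) hmem
      rintro x (rfl | rfl)
      · exact hpH
      · exact hH _ h1 h2
  · push Not at hex
    rcases main (p + n + 2) (by omega) (fun q hq hd => Or.inl (hex q hq hd)) with h | h
    · exact h
    · have := hp.pos
      rw [show p + n + 2 - 1 = p + n + 1 by omega] at h
      nlinarith

/-- nonnegative combinations of the prime divisors of `m` -/
def HH (m : ℕ) : AddSubmonoid ℕ where
  carrier := {n | ∃ f : ℕ → ℕ, n = ∑ p ∈ m.primeFactors, f p * p}
  zero_mem' := ⟨0, by simp⟩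
  add_mem' := by
    rintro a b ⟨f, rfl⟩ ⟨g, rfl⟩
    exact ⟨f + g, by simp [add_mul, Finset.sum_add_distrib]⟩

lemma HH_prime {m : ℕ} (hm : 2 ≤ m) (q : ℕ) (hq : q.Prime) (hd : q ∣ m) : q ∈ HH m := by
  refine ⟨fun p => if p = q then 1 else 0, ?_⟩
  have : q ∈ m.primeFactors := Nat.mem_primeFactors.2 ⟨hq, hd, by omega⟩
  simp [ite_mul, this]

lemma SS_finset {m : ℕ} (s : Finset ℂ) (hs : ∀ z ∈ s, z ^ m = 1) : (∑ z ∈ s, z, s.card) ∈ SS m := by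
  have : (∑ z ∈ s, z, s.card) = ∑ z ∈ s, (z, 1) := by
    ext <;> simp [Prod.fst_sum, Prod.snd_sum]
  rw [this]
  exact sum_mem fun z hz => AddSubmonoid.subset_closure ⟨hs z hz, rfl⟩

theorem sivek_necessity (m n : ℕ) (hm : 2 ≤ m) (hn : 2 ≤ n) (hnm : n ≤ m)
    (x : Fin n → ℂ) (hinj : Function.Injective x) (hx : ∀ i, x i ^ m = 1)
    (hsum : ∑ i, x i = 0) :
    (∃ f : ℕ → ℕ, n = ∑ p ∈ m.primeFactors, f p * p) ∧
    (∃ g : ℕ → ℕ, m - n = ∑ p ∈ m.primeFactors, g p * p) := by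
  classical
  set s : Finset ℂ := Finset.univ.image x with hs
  have hcard : s.card = n := by rw [hs, Finset.card_image_of_injective _ hinj]; simp
  have hsum' : ∑ z ∈ s, z = 0 := by
    rw [hs, Finset.sum_image (fun a _ b _ h => hinj h)]; exact hsum
  have hroot : ∀ z ∈ s, z ^ m = 1 := by
    intro z hz
    obtain ⟨i, _, rfl⟩ := Finset.mem_image.1 hz
    exact hx i
  have hζ := Complex.isPrimitiveRoot_exp m (by omega)
  set ζ := Complex.exp (2 * Real.pi * Complex.I / (m : ℂ))
  have : NeZero m := ⟨by omega⟩
  have hinj' : Set.InjOn (fun i => ζ ^ i) (Finset.range m : Set ℕ) := by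
    intro a ha b hb hab
    exact hζ.pow_inj (by simpa using ha) (by simpa using hb) hab
  set t : Finset ℂ := (Finset.range m).image (fun i => ζ ^ i) with ht
  have htcard : t.card = m := by rw [ht, Finset.card_image_of_injOn hinj', Finset.card_range]
  have htsum : ∑ z ∈ t, z = 0 := by
    rw [ht, Finset.sum_image hinj']; exact hζ.geom_sum_eq_zero (by omega)
  have hst : s ⊆ t := by
    intro z hz
    obtain ⟨i, hi, rfl⟩ := hζ.eq_pow_of_pow_eq_one (hroot z hz)
    exact Finset.mem_image.2 ⟨i, Finset.mem_range.2 hi, rfl⟩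
  have htroot : ∀ z ∈ t, z ^ m = 1 := by
    intro z hz
    obtain ⟨i, _, rfl⟩ := Finset.mem_image.1 hz
    rw [← pow_mul, mul_comm, pow_mul, hζ.pow_eq_one, one_pow]
  constructor
  · have h := SS_finset s hroot
    rw [hsum', hcard] at h
    exact lam_leung_s12 (H := HH m) hm (HH_prime hm) h
  · have h := SS_finset (t \ s) (fun z hz => htroot z (Finset.sdiff_subset hz))
    have h1 := Finset.sum_sdiff (f := fun z => z) hst
    rw [hsum', htsum, add_zero] at h1
    rw [h1, Finset.card_sdiff_of_subset hst, hcard, htcard] at h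
    exact lam_leung_s12 (H := HH m) hm (HH_prime hm) h
end
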